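/- Let g be odd, Γ̄ the tropical hyperelliptic curve of genus g, Γ its bounded part, and D* = ((g−1)/2)(V_0 + V_0′) + V_0. For any points P_1, …, P_{(g−1)/2} on Γ with conjugates P_1′, …, P_{(g−1)/2}′, there exists a rational function h on Γ with (h) = V_0 + P_1 + ⋯ + P_{(g−1)/2} + P_1′ + ⋯ + P_{(g−1)/2}′ − D*; equivalently (V_0 P_1 ⋯ P_{(g−1)/2} P_1′ ⋯ P_{(g−1)/2}′) = φ̄(V_0 + Σ P_i + Σ P_i′) = 0 in J(Γ). -/

import Mathlib

open scoped BigOperators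

namespace TropicalHyperelliptic

/-! ## The tropical hyperelliptic curve

For a genus `g ≥ 1` and parameters `c₋₁, c₀, …, c_{g+1}` (encoded as a function
`c : ℤ → ℝ`; only the values `c (-1), …, c (g+1)` matter), the tropical
polynomial `F̃(X,Y) = max(2Y, Y + P̃(X), c₋₁)` with
`P̃(X) = max_{0 ≤ i ≤ g+1} (c_i + iX)` defines the tropical hyperelliptic curve
`Γ̄` as the locus of points of `ℝ²` where `F̃` fails to be differentiable. -/

/-- The tropical polynomial `P̃(X) = max_{0 ≤ i ≤ g+1} (c_i + i X)`. -/
noncomputable def Ptilde (g : ℕ) (c : ℤ → ℝ) (X : ℝ) : ℝ :=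
  (Finset.range (g + 2)).sup' (Finset.nonempty_range_iff.mpr (by omega))
    fun i => c (i : ℤ) + (i : ℝ) * X

/-- The tropical polynomial `F̃(X,Y) = max(2Y, Y + P̃(X), c₋₁)`. -/
noncomputable def Ftilde (g : ℕ) (c : ℤ → ℝ) (P : ℝ × ℝ) : ℝ :=
  max (2 * P.2) (max (P.2 + Ptilde g c P.1) (c (-1)))

/-- The tropical hyperelliptic curve `Γ̄` of genus `g`: the set of points of
`ℝ²` at which `F̃` is not differentiable. -/
def curveBar (g : ℕ) (c : ℤ → ℝ) : Set (ℝ × ℝ) :=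
  {P | ¬ DifferentiableAt ℝ (Ftilde g c) P}

/-- The hypotheses on the parameters: `c_{g+1} = c_g = 0`, `c₋₁ < 2c₀`,
`cᵢ + c_{i+2} < 2c_{i+1}` for `0 ≤ i ≤ g − 2`, and `c_{g−1} < 2c_g = 0`.
Under these assumptions `Γ̄` is a smooth tropical curve of genus `g`. -/
def Hyp (g : ℕ) (c : ℤ → ℝ) : Prop :=
  c ((g : ℤ) + 1) = 0 ∧ c (g : ℤ) = 0 ∧ c (-1) < 2 * c 0 ∧
  (∀ i : ℕ, (i : ℤ) ≤ (g : ℤ) - 2 → c i + c ((i : ℤ) + 2) < 2 * c ((i : ℤ) + 1)) ∧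
  c ((g : ℤ) - 1) < 0

/-- The vertices `V_i` (`0 ≤ i ≤ g`) of `Γ̄` lying above the line
`Y = c₋₁/2`:  `V_0 = (0,0)` and
`V_i = (c_{g−i} − c_{g−i+1}, (g−i+1)c_{g−i} − (g−i)c_{g−i+1})`.
(The formula below also gives `V_0 = (0,0)` for `i = 0`, since
`c_g = c_{g+1} = 0`.) -/
noncomputable def V (g : ℕ) (c : ℤ → ℝ) (i : ℕ) : ℝ × ℝ :=
  (c ((g : ℤ) - i) - c ((g : ℤ) - i + 1),
   (((g : ℤ) - i + 1 : ℤ) : ℝ) * c ((g : ℤ) - i)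
     - (((g : ℤ) - i : ℤ) : ℝ) * c ((g : ℤ) - i + 1))

/-- The conjugate `P′` of a point `P`: the reflection with respect to the line
`Y = c₋₁/2`. -/
def conj (c : ℤ → ℝ) (P : ℝ × ℝ) : ℝ × ℝ := (P.1, c (-1) - P.2)

/-- The metric graph `Γ` obtained from `Γ̄` by removing all unbounded edges:
the part of `Γ̄` lying in the vertical strip `x(V_g) ≤ X ≤ x(V_0) = 0`,
where `x(V_g) = c_0 − c_1`. -/
def Gam (g : ℕ) (c : ℤ → ℝ) : Set (ℝ × ℝ) :=
  {P ∈ curveBar g c | c 0 - c 1 ≤ P.1 ∧ P.1 ≤ 0}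

/-! ## Rational functions, orders, and divisors -/

/-- The image in `ℝ²` of an integer vector. -/
def vr (v : ℤ × ℤ) : ℝ × ℝ := ((v.1 : ℝ), (v.2 : ℝ))

/-- The primitive integer directions along which one can leave the point `P`
inside the set `S` (the outgoing directions of the segments of `S` emanating
from `P`). -/
def localDirs (S : Set (ℝ × ℝ)) (P : ℝ × ℝ) : Set (ℤ × ℤ) :=
  {v | IsCoprime v.1 v.2 ∧ ∃ ε > (0 : ℝ), ∀ t : ℝ, 0 < t → t < ε → P + t • vr v ∈ S}

/-- `f` has (integer) outgoing slope `s` at `P` in the direction `v` (slopes are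
measured with respect to the lattice length). -/
def HasSlope (S : Set (ℝ × ℝ)) (f : ℝ × ℝ → ℝ) (P : ℝ × ℝ) (v : ℤ × ℤ) (s : ℤ) : Prop :=
  ∃ ε > (0 : ℝ), ∀ t : ℝ, 0 ≤ t → t < ε → P + t • vr v ∈ S →
    f (P + t • vr v) = f P + (s : ℝ) * t

/-- A rational function on (the tropical curve) `S ⊆ ℝ²`: a continuous function
whose restriction to every edge is piecewise linear with integer slopes,
i.e. which has an integer outgoing slope at every point of `S` in every
outgoing direction. -/
structure IsRationalFn (S : Set (ℝ × ℝ)) (f : ℝ × ℝ → ℝ) : Prop where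
  cont : ContinuousOn f S
  slope_int : ∀ P ∈ S, ∀ v ∈ localDirs S P, ∃ s : ℤ, HasSlope S f P v s

/-- The outgoing slope of `f` at `P` in the direction `v` (defaulting to `0`
when no integer slope exists). -/
noncomputable def slope (S : Set (ℝ × ℝ)) (f : ℝ × ℝ → ℝ) (P : ℝ × ℝ) (v : ℤ × ℤ) : ℤ :=
  open scoped Classical in
  if h : ∃ s : ℤ, HasSlope S f P v s then h.choose else 0

/-- The order `ord_P f`: the sum of the outgoing slopes of `f` over all segments
of `S` emanating from `P`.  Points with `ord_P f > 0` are the zeros of `f`,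
points with `ord_P f < 0` its poles. -/
noncomputable def ord (S : Set (ℝ × ℝ)) (f : ℝ × ℝ → ℝ) (P : ℝ × ℝ) : ℤ :=
  ∑ᶠ v ∈ localDirs S P, slope S f P v

/-- Divisors: formal `ℤ`-linear combinations of finitely many points of `ℝ²`. -/
abbrev Div := (ℝ × ℝ) →₀ ℤ

/-- The degree of a divisor: the sum of its coefficients. -/
def deg (D : Div) : ℤ := D.sum fun _ n => n

/-- A divisor is effective (`D > 0`) when all its coefficients are nonnegative. -/
def Eff (D : Div) : Prop := ∀ P, 0 ≤ D P

/-- `R(D)`: the set of rational functions `f` on `S` with `(f) + D` effective. -/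
def RSet (S : Set (ℝ × ℝ)) (D : Div) : Set ((ℝ × ℝ) → ℝ) :=
  {f | IsRationalFn S f ∧ ∀ P ∈ S, 0 ≤ ord S f P + D P}

/-- A divisor is principal when it is the divisor `(f) = Σ_P (ord_P f)·P` of a
rational function `f` on `S`. -/
def IsPrincipal (S : Set (ℝ × ℝ)) (D : Div) : Prop :=
  ∃ f : (ℝ × ℝ) → ℝ, IsRationalFn S f ∧ ∀ P, D P = ord S f P

/-- Two divisors are (linearly) equivalent, `D ∼ D′`, when `D′ = D + (f)` for
some rational function `f` on `S`. -/
def LinEquiv (S : Set (ℝ × ℝ)) (D D' : Div) : Prop :=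
  ∃ f : (ℝ × ℝ) → ℝ, IsRationalFn S f ∧ ∀ P, D' P = D P + ord S f P

end TropicalHyperelliptic

/-! ## The cycles `α_i` and the set `𝔇̃_g^+(Γ)` -/

namespace TropicalHyperelliptic

/-- The basis cycle `α_i` (`1 ≤ i ≤ g`) of the fundamental group `π₁(Γ)`:
the cycle of `Γ` through the vertices `V_{i−1}`, `V_i` and their conjugates
`V_{i−1}′`, `V_i′`, i.e. the part of `Γ` in the vertical strip
`x(V_i) ≤ X ≤ x(V_{i−1})`. -/
def alphaCycle (g : ℕ) (c : ℤ → ℝ) (i : ℕ) : Set (ℝ × ℝ) :=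
  {P ∈ Gam g c | (V g c i).1 ≤ P.1 ∧ P.1 ≤ (V g c (i - 1)).1}

/-- The overlap `α_{k,k+1} = (α_k ∩ α_{k+1}) ∖ {endpoints}` (`1 ≤ k ≤ g − 1`):
the open vertical edge of `Γ` joining `V_k` to `V_k′`.  (For non-adjacent
indices the overlaps `α_i ∩ α_j` are empty.) -/
def alphaOpen (g : ℕ) (c : ℤ → ℝ) (k : ℕ) : Set (ℝ × ℝ) :=
  {P ∈ Gam g c | P.1 = (V g c k).1 ∧ P ≠ V g c k ∧ P ≠ conj c (V g c k)}

/-- The subset `𝔇̃_g^+(Γ)` of `𝔇_g^+(Γ)`: effective divisors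
`P_1 + ⋯ + P_g` with `P_i ∈ α_i` for all `i`, such that each overlap `α_{ij}`
contains at most one of the points. -/
def Dtilde (g : ℕ) (c : ℤ → ℝ) : Set Div :=
  {D | ∃ Pt : Fin g → ℝ × ℝ,
    (∀ i : Fin g, Pt i ∈ alphaCycle g c (i + 1)) ∧
    (∀ k : ℕ, 1 ≤ k → k ≤ g - 1 →
      ∀ i j : Fin g, Pt i ∈ alphaOpen g c k → Pt j ∈ alphaOpen g c k → i = j) ∧
    D = ∑ i : Fin g, Finsupp.single (Pt i) (1 : ℤ)}

/-- For even `g`, the base divisor `D* = (g/2)(V_0 + V_0′)`. -/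
noncomputable def DstarEven (g : ℕ) (c : ℤ → ℝ) : Div :=
  ((g / 2 : ℕ) : ℤ) •
    (Finsupp.single (V g c 0) (1 : ℤ) + Finsupp.single (conj c (V g c 0)) (1 : ℤ))

/-- For odd `g`, the base divisor `D* = ((g−1)/2)(V_0 + V_0′) + V_0`. -/
noncomputable def DstarOdd (g : ℕ) (c : ℤ → ℝ) : Div :=
  (((g - 1) / 2 : ℕ) : ℤ) •
    (Finsupp.single (V g c 0) (1 : ℤ) + Finsupp.single (conj c (V g c 0)) (1 : ℤ))
  + Finsupp.single (V g c 0) (1 : ℤ)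

end TropicalHyperelliptic

open TropicalHyperelliptic

namespace TropicalHyperelliptic

def Kink (g : ℕ) (c : ℤ → ℝ) (X : ℝ) : Prop :=
  ∃ k : ℕ, k ≤ g ∧ X = c k - c ((k : ℤ) + 1)

lemma kink_finite (g : ℕ) (c : ℤ → ℝ) : {X | Kink g c X}.Finite := by
  have : {X | Kink g c X} = (fun k : ℕ => c k - c ((k : ℤ) + 1)) '' (Set.Iic g) := by
    ext X
    constructor
    · rintro ⟨k, hk, rfl⟩
      exact ⟨k, hk, rfl⟩
    · rintro ⟨k, hk, rfl⟩
      exact ⟨k, hk, rfl⟩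
  rw [this]
  exact (Set.finite_Iic g).image _

lemma kink_sep (g : ℕ) (c : ℤ → ℝ) (a : ℝ) :
    ∃ δ > (0 : ℝ), ∀ X, Kink g c X → X ≠ a → δ ≤ |X - a| := by
  have hfin : ({X | Kink g c X} \ {a}).Finite := (kink_finite g c).sdiff
  have hopen : IsOpen ({X | Kink g c X} \ {a})ᶜ := hfin.isClosed.isOpen_compl
  obtain ⟨δ, hδ, hb⟩ := Metric.isOpen_iff.1 hopen a (by simp)
  refine ⟨δ, hδ, fun X hX hXa => ?_⟩
  by_contra hlt
  push Not at hlt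
  exact hb (show X ∈ Metric.ball a δ by rwa [Metric.mem_ball, Real.dist_eq]) ⟨hX, hXa⟩

lemma x_succ_lt {g : ℕ} {c : ℤ → ℝ} (hc : Hyp g c) (i : ℕ) (hi : i + 1 ≤ g) :
    c i - c ((i : ℤ) + 1) < c ((i + 1 : ℕ) : ℤ) - c (((i + 1 : ℕ) : ℤ) + 1) := by
  obtain ⟨h1, h2, h3, h4, h5⟩ := hc
  have e : (((i + 1 : ℕ) : ℤ) + 1) = (i : ℤ) + 2 := by push_cast; ring
  have e' : (((i + 1 : ℕ) : ℤ)) = (i : ℤ) + 1 := by push_cast; ring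
  rw [e, e']
  rcases Nat.lt_or_ge (i + 1) g with h | h
  · have := h4 i (by omega)
    linarith
  · have hg : (g : ℤ) = (i : ℤ) + 1 := by omega
    rw [hg] at h1 h2 h5
    have e1 : (i : ℤ) + 1 + 1 = (i : ℤ) + 2 := by ring
    have e2 : (i : ℤ) + 1 - 1 = (i : ℤ) := by ring
    rw [e1] at h1
    rw [e2] at h5
    linarith

lemma x_mono {g : ℕ} {c : ℤ → ℝ} (hc : Hyp g c) (i j : ℕ) (hij : i ≤ j) (hj : j ≤ g) :
    c i - c ((i : ℤ) + 1) ≤ c j - c ((j : ℤ) + 1) := by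
  induction j, hij using Nat.le_induction with
  | base => exact le_rfl
  | succ n hn ih =>
    exact (ih (by omega)).trans (x_succ_lt hc n hj).le

lemma le_Ptilde (g : ℕ) (c : ℤ → ℝ) (X : ℝ) (k : ℕ) (hk : k ≤ g + 1) :
    c k + k * X ≤ Ptilde g c X := by
  unfold Ptilde
  exact Finset.le_sup' (fun i : ℕ => c (i : ℤ) + (i : ℝ) * X) (Finset.mem_range.2 (by omega))

lemma Ptilde_eq (g : ℕ) (c : ℤ → ℝ) (X : ℝ) (k : ℕ) (hk : k ≤ g + 1)
    (h1 : ∀ j : ℕ, j < k → c j - c ((j : ℤ) + 1) ≤ X)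
    (h2 : ∀ j : ℕ, k ≤ j → j ≤ g → X ≤ c j - c ((j : ℤ) + 1)) :
    Ptilde g c X = c k + k * X := by
  apply le_antisymm _ (le_Ptilde g c X k hk)
  unfold Ptilde
  apply Finset.sup'_le
  intro i hi
  have hi' : i ≤ g + 1 := by have := Finset.mem_range.1 hi; omega
  rcases le_total i k with h | h
  · have key : ∀ n : ℕ, i ≤ n → n ≤ k → c i + i * X ≤ c n + n * X := by
      intro n hn
      induction n, hn using Nat.le_induction with
      | base => intro _; exact le_rfl
      | succ n hn ih =>
        intro hnk
        have a := ih (by omega)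
        have b := h1 n (by omega)
        push_cast
        linarith
    exact key k h le_rfl
  · have key : ∀ n : ℕ, k ≤ n → n ≤ g + 1 → c n + n * X ≤ c k + k * X := by
      intro n hn
      induction n, hn using Nat.le_induction with
      | base => intro _; exact le_rfl
      | succ n hn ih =>
        intro hnk
        have a := ih (by omega)
        have b := h2 n hn (by omega)
        push_cast
        linarith
    exact key i h hi'

lemma Ptilde_zero {g : ℕ} {c : ℤ → ℝ} (hc : Hyp g c) : Ptilde g c 0 = 0 := by
  have hx : c g - c ((g : ℤ) + 1) = 0 := by rw [hc.1, hc.2.1]; simp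
  rw [Ptilde_eq g c 0 g (by omega), hc.2.1]
  · simp
  · intro j hj
    rw [← hx]
    exact x_mono hc j g hj.le le_rfl
  · intro j hj hj'
    have : j = g := by omega
    subst this
    exact hx.ge

lemma support_deriv (f : ℝ → ℝ) (D X m b : ℝ) (hD : HasDerivAt f D X)
    (h1 : ∀ x, m * x + b ≤ f x) (h2 : f X = m * X + b) : D = m := by
  have h3 : HasDerivAt (fun x => m * x + b) m X := by
    simpa using ((hasDerivAt_id X).const_mul m).add_const b
  have h4 : HasDerivAt (fun x => f x - (m * x + b)) (D - m) X := HasDerivAt.fun_sub hD h3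
  have : D - m = 0 := by
    refine IsLocalMin.hasDerivAt_eq_zero (Filter.Eventually.of_forall fun y => ?_) h4
    have := h1 y
    linarith
  linarith

lemma kink_not_diff (g : ℕ) (c : ℤ → ℝ) (X : ℝ) (hX : Kink g c X)
    (hP : ∀ k : ℕ, k ≤ g → X = c k - c ((k : ℤ) + 1) → Ptilde g c X = c k + k * X) :
    ¬ DifferentiableAt ℝ (Ptilde g c) X := by
  intro hd
  obtain ⟨k, hk, hXk⟩ := hX
  have hPk := hP k hk hXk
  have hD := hd.hasDerivAt
  have l1 := support_deriv _ _ _ k (c k) hD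
    (fun x => by have := le_Ptilde g c x k (by omega); linarith) (by linarith)
  have l2 := support_deriv _ _ _ (k + 1) (c ((k : ℤ) + 1)) hD
    (fun x => by
      have := le_Ptilde g c x (k + 1) (by omega)
      push_cast at this
      linarith) (by linarith)
  linarith

lemma kink_Ptilde {g : ℕ} {c : ℤ → ℝ} (hc : Hyp g c) (X : ℝ) (k : ℕ) (hk : k ≤ g)
    (hX : X = c k - c ((k : ℤ) + 1)) : Ptilde g c X = c k + k * X := by
  apply Ptilde_eq g c X k (by omega)
  · intro j hj
    rw [hX]; exact x_mono hc j k hj.le hk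
  · intro j hj hjg
    rw [hX]; exact x_mono hc k j hj hjg

lemma nonkink_local {g : ℕ} {c : ℤ → ℝ} (hc : Hyp g c) (X : ℝ) (hX : X ≤ 0)
    (hk : ¬ Kink g c X) :
    ∃ k : ℕ, ∀ᶠ x in nhds X, Ptilde g c x = c k + k * x := by
  classical
  have hx : c g - c ((g : ℤ) + 1) = 0 := by rw [hc.1, hc.2.1]; simp
  have hex : ∃ j : ℕ, X ≤ c j - c ((j : ℤ) + 1) := ⟨g, by rw [hx]; exact hX⟩
  set k := Nat.find hex with hkdef
  have hkg : k ≤ g := Nat.find_min' hex (by rw [hx]; exact hX)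
  have hspec : X ≤ c k - c ((k : ℤ) + 1) := Nat.find_spec hex
  refine ⟨k, ?_⟩
  have e1 : ∀ᶠ x in nhds X, ∀ j ∈ Finset.range k, c j - c ((j : ℤ) + 1) < x := by
    rw [Filter.eventually_all_finset]
    intro j hj
    apply lt_mem_nhds
    have := Nat.find_min hex (Finset.mem_range.1 hj)
    exact not_le.1 this
  have e2 : ∀ᶠ x in nhds X, ∀ j ∈ Finset.Icc k g, x < c j - c ((j : ℤ) + 1) := by
    rw [Filter.eventually_all_finset]
    intro j hj
    rw [Finset.mem_Icc] at hj
    apply gt_mem_nhds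
    apply lt_of_le_of_ne (hspec.trans (x_mono hc k j hj.1 hj.2))
    intro h
    exact hk ⟨j, hj.2, h⟩
  filter_upwards [e1, e2] with x h1 h2
  apply Ptilde_eq g c x k (by omega)
  · intro j hj
    exact (h1 j (Finset.mem_range.2 hj)).le
  · intro j hj hjg
    exact (h2 j (Finset.mem_Icc.2 ⟨hj, hjg⟩)).le

lemma Ptilde_cont (g : ℕ) (c : ℤ → ℝ) : Continuous (Ptilde g c) := by
  unfold Ptilde
  apply Continuous.finset_sup'_apply
  intro i _
  fun_prop

lemma Ptilde_pos {g : ℕ} {c : ℤ → ℝ} (hc : Hyp g c) (X : ℝ) : 0 < Ptilde g c X - c (-1) / 2 := by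
  have := le_Ptilde g c X 0 (by omega)
  have h := hc.2.2.1
  simp at this
  linarith

/-- one-sided slopes exist for a finite maximum of integer affine functions -/
def OneSided (f : ℝ → ℝ) (X : ℝ) (τ : ℤ) (s : ℤ) : Prop :=
  ∃ ε > (0 : ℝ), ∀ t : ℝ, 0 ≤ t → t < ε → f (X + τ * t) = f X + τ * s * t

lemma Ptilde_oneSided (g : ℕ) (c : ℤ → ℝ) (X : ℝ) (τ : ℤ) (hτ : τ = 1 ∨ τ = -1) :
    ∃ s : ℤ, OneSided (Ptilde g c) X τ s := by
  have hττ : τ * τ = 1 := by rcases hτ with h | h <;> subst h <;> rfl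
  suffices H : ∀ (S : Finset ℕ) (hS : S.Nonempty), ∃ s : ℤ, OneSided
      (fun X => S.sup' hS fun i => c (i : ℤ) + (i : ℝ) * X) X τ s by
    exact H _ _
  intro S hS
  induction hS using Finset.Nonempty.cons_induction with
  | singleton a =>
    refine ⟨a, 1, one_pos, fun t _ _ => ?_⟩
    simp
    ring
  | cons a S ha hS ih =>
    obtain ⟨s, ε, hε, hs⟩ := ih
    simp only [Finset.sup'_cons hS]
    set M : ℝ → ℝ := fun X => S.sup' hS fun i => c (i : ℤ) + (i : ℝ) * X with hM
    have hs' : ∀ t : ℝ, 0 ≤ t → t < ε → M (X + τ * t) = M X + τ * s * t := hs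
    have goalform : ∀ r : ℤ, OneSided (fun x => max (c (a : ℤ) + (a : ℝ) * x) (M x)) X τ r →
      ∃ s : ℤ, OneSided (fun X => (c (a : ℤ) + (a : ℝ) * X) ⊔
        S.sup' hS fun i => c (i : ℤ) + (i : ℝ) * X) X τ s := fun r hr => ⟨r, hr⟩
    rcases lt_trichotomy (c (a : ℤ) + (a : ℝ) * X) (M X) with h | h | h
    · apply goalform s
      have hK : 0 < |(τ : ℝ) * a| + |(τ : ℝ) * s| + 1 := by positivity
      refine ⟨min ε ((M X - (c (a : ℤ) + (a : ℝ) * X)) / (|(τ : ℝ) * a| + |(τ : ℝ) * s| + 1)),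
        lt_min hε (div_pos (by linarith) hK), fun t ht0 ht => ?_⟩
      have ht1 := lt_of_lt_of_le ht (min_le_left _ _)
      have ht2 := lt_of_lt_of_le ht (min_le_right _ _)
      rw [lt_div_iff₀ hK] at ht2
      simp only
      rw [hs' t ht0 ht1, max_eq_right h.le, max_eq_right]
      have b1 := le_abs_self ((τ : ℝ) * a)
      have b2 := neg_abs_le ((τ : ℝ) * s)
      nlinarith
    · apply goalform (if τ * s ≤ τ * a then a else s)
      refine ⟨ε, hε, fun t ht0 ht => ?_⟩
      simp only
      rw [hs' t ht0 ht, h, max_self]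
      split_ifs with h'
      · have h'' : (τ : ℝ) * s ≤ τ * a := by exact_mod_cast h'
        rw [max_eq_left]
        · push_cast; linear_combination h
        · nlinarith
      · have h'' : (τ : ℝ) * a ≤ τ * s := by push Not at h'; exact_mod_cast h'.le
        rw [max_eq_right]
        nlinarith
    · apply goalform a
      have hK : 0 < |(τ : ℝ) * a| + |(τ : ℝ) * s| + 1 := by positivity
      refine ⟨min ε ((c (a : ℤ) + (a : ℝ) * X - M X) / (|(τ : ℝ) * a| + |(τ : ℝ) * s| + 1)),
        lt_min hε (div_pos (by linarith) hK), fun t ht0 ht => ?_⟩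
      have ht1 := lt_of_lt_of_le ht (min_le_left _ _)
      have ht2 := lt_of_lt_of_le ht (min_le_right _ _)
      rw [lt_div_iff₀ hK] at ht2
      simp only
      rw [hs' t ht0 ht1, max_eq_left h.le, max_eq_left]
      · push_cast; ring
      have b1 := neg_abs_le ((τ : ℝ) * a)
      have b2 := le_abs_self ((τ : ℝ) * s)
      nlinarith

lemma mem_curve_iff {g : ℕ} {c : ℤ → ℝ} (hc : Hyp g c) (Q : ℝ × ℝ) (hQ : Q.1 ≤ 0) :
    Q ∈ curveBar g c ↔ (|Q.2 - c (-1) / 2| = Ptilde g c Q.1 - c (-1) / 2 ∨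
      (|Q.2 - c (-1) / 2| < Ptilde g c Q.1 - c (-1) / 2 ∧ Kink g c Q.1)) := by
  have hcont := Ptilde_cont g c
  have hpos := Ptilde_pos hc Q.1
  obtain ⟨X, Y⟩ := Q
  simp only at hQ hpos ⊢
  show ¬ DifferentiableAt ℝ (Ftilde g c) (X, Y) ↔ _
  have hinc : HasDerivAt (fun y : ℝ => ((X, y) : ℝ × ℝ)) ((0, 1) : ℝ × ℝ) Y :=
    (hasDerivAt_const Y X).prodMk (hasDerivAt_id Y)
  have hinc' : HasDerivAt (fun x : ℝ => ((x, Y) : ℝ × ℝ)) ((1, 0) : ℝ × ℝ) X :=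
    (hasDerivAt_id X).prodMk (hasDerivAt_const X Y)
  constructor
  · intro hnd
    by_contra hcon
    push Not at hcon
    obtain ⟨hne, hcon⟩ := hcon
    apply hnd
    rcases lt_or_gt_of_ne hne with h | h
    · have hk := hcon h
      obtain ⟨k, hk⟩ := nonkink_local hc X hQ hk
      have hk' : ∀ᶠ P : ℝ × ℝ in nhds (X, Y), Ptilde g c P.1 = c k + k * P.1 :=
        (continuous_fst.tendsto (X, Y)).eventually hk
      have ho : ∀ᶠ P : ℝ × ℝ in nhds (X, Y),
          |P.2 - c (-1) / 2| < Ptilde g c P.1 - c (-1) / 2 := by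
        apply (isOpen_lt (by fun_prop) (by fun_prop)).mem_nhds
        exact h
      have he : Ftilde g c =ᶠ[nhds (X, Y)] fun P => P.2 + (c k + k * P.1) := by
        filter_upwards [hk', ho] with P h1 h2
        rw [← h1]
        unfold Ftilde
        rw [abs_lt] at h2
        rw [max_eq_left (by linarith : c (-1) ≤ P.2 + Ptilde g c P.1), max_eq_right (by linarith)]
      exact DifferentiableAt.congr_of_eventuallyEq (by fun_prop) he
    · rcases lt_abs.1 h with h | h
      · have ho : ∀ᶠ P : ℝ × ℝ in nhds (X, Y), Ptilde g c P.1 < P.2 := by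
          apply (isOpen_lt (by fun_prop) (by fun_prop)).mem_nhds
          show Ptilde g c X < Y
          linarith
        have he : Ftilde g c =ᶠ[nhds (X, Y)] fun P => 2 * P.2 := by
          filter_upwards [ho] with P h1
          have := Ptilde_pos hc P.1
          unfold Ftilde
          rw [max_eq_left]
          apply max_le <;> linarith
        exact DifferentiableAt.congr_of_eventuallyEq (by fun_prop) he
      · have ho : ∀ᶠ P : ℝ × ℝ in nhds (X, Y), P.2 + Ptilde g c P.1 < c (-1) := by
          apply (isOpen_lt (by fun_prop) (by fun_prop)).mem_nhds
          show Y + Ptilde g c X < _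
          linarith
        have he : Ftilde g c =ᶠ[nhds (X, Y)] fun P => c (-1) := by
          filter_upwards [ho] with P h1
          have := Ptilde_pos hc P.1
          unfold Ftilde
          rw [max_eq_right h1.le, max_eq_right]
          linarith
        exact DifferentiableAt.congr_of_eventuallyEq (by fun_prop) he
  · rintro (h | ⟨h, hk⟩) hd
    · have hD : HasDerivAt (fun y => Ftilde g c (X, y)) (fderiv ℝ (Ftilde g c) (X, Y) (0, 1)) Y :=
        hd.hasFDerivAt.comp_hasDerivAt Y hinc
      set D := fderiv ℝ (Ftilde g c) (X, Y) (0, 1)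
      have gen : ∀ (m b : ℝ), (∀ y, m * y + b ≤ Ftilde g c (X, y)) →
          Ftilde g c (X, Y) = m * Y + b → D = m := by
        intro m b h1 h2
        exact support_deriv _ _ _ _ _ hD h1 h2
      have d1 : D = 1 := by
        apply gen 1 (Ptilde g c X)
        · intro y
          unfold Ftilde
          refine le_max_of_le_right (le_max_of_le_left ?_)
          simp
        · unfold Ftilde
          simp only [one_mul]
          have h1 := abs_le.1 h.le
          rw [max_eq_left (by linarith : c (-1) ≤ Y + Ptilde g c X), max_eq_right (by linarith)]
      rcases abs_choice (Y - c (-1) / 2) with h' | h' <;> rw [h'] at h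
      · have : D = 2 := by
          apply gen 2 0
          · intro y
            unfold Ftilde
            refine le_max_of_le_left ?_
            simp
          · unfold Ftilde
            simp only [add_zero]
            rw [max_eq_left]
            apply max_le <;> linarith
        linarith
      · have : D = 0 := by
          apply gen 0 (c (-1))
          · intro y
            unfold Ftilde
            refine le_max_of_le_right (le_max_of_le_right ?_)
            simp
          · unfold Ftilde
            simp only [zero_mul, zero_add]
            rw [max_eq_right (by linarith : Y + Ptilde g c X ≤ c (-1)), max_eq_right]
            linarith
        linarith
    · have hD : HasDerivAt (fun x => Ftilde g c (x, Y)) (fderiv ℝ (Ftilde g c) (X, Y) (1, 0)) X :=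
        HasFDerivAt.comp_hasDerivAt X (l := Ftilde g c) hd.hasFDerivAt hinc'
      have ho : ∀ᶠ x : ℝ in nhds X, |Y - c (-1) / 2| < Ptilde g c x - c (-1) / 2 := by
        apply (isOpen_lt (by fun_prop) (by fun_prop)).mem_nhds
        exact h
      have he : Ptilde g c =ᶠ[nhds X] fun x => Ftilde g c (x, Y) - Y := by
        filter_upwards [ho] with x h2
        unfold Ftilde
        rw [abs_lt] at h2
        simp only
        rw [max_eq_left (by linarith : c (-1) ≤ Y + Ptilde g c x), max_eq_right (by linarith)]
        ring
      exact kink_not_diff g c X hk (kink_Ptilde hc X)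
        ((hD.differentiableAt.sub_const Y).congr_of_eventuallyEq he)

end TropicalHyperelliptic

namespace TropicalHyperelliptic

open Filter Topology

lemma ev_iff (p : ℝ → Prop) :
    (∃ ε > (0 : ℝ), ∀ t : ℝ, 0 < t → t < ε → p t) ↔ ∀ᶠ t in 𝓝[>] (0 : ℝ), p t := by
  constructor
  · rintro ⟨ε, hε, h⟩
    filter_upwards [Ioo_mem_nhdsGT hε] with t ht using h t ht.1 ht.2
  · intro h
    obtain ⟨ε, hε, h'⟩ := mem_nhdsGT_iff_exists_Ioo_subset.1 h
    exact ⟨ε, hε, fun t h1 h2 => h' ⟨h1, h2⟩⟩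

lemma ev_lt (K B : ℝ) (hB : 0 < B) : ∀ᶠ t in 𝓝[>] (0 : ℝ), t * K < B := by
  apply eventually_nhdsWithin_of_eventually_nhds
  have : Continuous fun t : ℝ => t * K := by fun_prop
  apply (isOpen_lt this continuous_const).mem_nhds
  simpa using hB

lemma ev_pos : ∀ᶠ t in 𝓝[>] (0 : ℝ), 0 < t := self_mem_nhdsWithin

lemma mem_localDirs (S : Set (ℝ × ℝ)) (P : ℝ × ℝ) (v : ℤ × ℤ) :
    v ∈ localDirs S P ↔ IsCoprime v.1 v.2 ∧ ∀ᶠ t in 𝓝[>] (0 : ℝ), P + t • vr v ∈ S := by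
  rw [← ev_iff]
  rfl

lemma hasSlope_of_ev (S : Set (ℝ × ℝ)) (f : ℝ × ℝ → ℝ) (P : ℝ × ℝ) (v : ℤ × ℤ) (s : ℤ)
    (h : ∀ᶠ t in 𝓝[>] (0 : ℝ), f (P + t • vr v) = f P + s * t) : HasSlope S f P v s := by
  obtain ⟨ε, hε, h⟩ := (ev_iff _).2 h
  refine ⟨ε, hε, fun t h0 h1 _ => ?_⟩
  rcases h0.eq_or_lt with h0 | h0
  · subst h0; simp
  · exact h t h0 h1

lemma slope_eq {S : Set (ℝ × ℝ)} {f : ℝ × ℝ → ℝ} {P : ℝ × ℝ} {v : ℤ × ℤ} {s : ℤ}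
    (hv : v ∈ localDirs S P) (h : HasSlope S f P v s) : slope S f P v = s := by
  have hex : ∃ s : ℤ, HasSlope S f P v s := ⟨s, h⟩
  unfold slope
  rw [dif_pos hex]
  obtain ⟨ε, hε, h1⟩ := hex.choose_spec
  obtain ⟨ε', hε', h2⟩ := h
  obtain ⟨t, ht, h3, h4, h5⟩ := (ev_pos.and (((mem_localDirs _ _ _).1 hv).2.and
    ((ev_lt 1 ε hε).and (ev_lt 1 ε' hε')))).exists
  have a1 := h1 t ht.le (by linarith) h3
  have a2 := h2 t ht.le (by linarith) h3
  rw [a1] at a2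
  have : (hex.choose : ℝ) * t = s * t := by linarith
  have := mul_right_cancel₀ ht.ne' this
  exact_mod_cast this

lemma mem_Gam_iff {g : ℕ} {c : ℤ → ℝ} (hc : Hyp g c) (Q : ℝ × ℝ) :
    Q ∈ Gam g c ↔ c 0 - c 1 ≤ Q.1 ∧ Q.1 ≤ 0 ∧
      (|Q.2 - c (-1) / 2| = Ptilde g c Q.1 - c (-1) / 2 ∨
      (|Q.2 - c (-1) / 2| < Ptilde g c Q.1 - c (-1) / 2 ∧ Kink g c Q.1)) := by
  unfold Gam
  simp only [Set.mem_ofPred_eq]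
  constructor
  · rintro ⟨h1, h2, h3⟩
    exact ⟨h2, h3, (mem_curve_iff hc Q h3).1 h1⟩
  · rintro ⟨h2, h3, h1⟩
    exact ⟨(mem_curve_iff hc Q h3).2 h1, h2, h3⟩

lemma Gam_closed {g : ℕ} {c : ℤ → ℝ} (hc : Hyp g c) : IsClosed (Gam g c) := by
  have hcont := Ptilde_cont g c
  have hK : IsClosed {Q : ℝ × ℝ | Kink g c Q.1} :=
    (kink_finite g c).isClosed.preimage continuous_fst
  have : Gam g c = {Q : ℝ × ℝ | c 0 - c 1 ≤ Q.1} ∩ ({Q : ℝ × ℝ | Q.1 ≤ 0} ∩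
      ({Q : ℝ × ℝ | |Q.2 - c (-1) / 2| = Ptilde g c Q.1 - c (-1) / 2} ∪
      ({Q : ℝ × ℝ | |Q.2 - c (-1) / 2| ≤ Ptilde g c Q.1 - c (-1) / 2} ∩
        {Q : ℝ × ℝ | Kink g c Q.1}))) := by
    ext Q
    rw [mem_Gam_iff hc]
    simp only [Set.mem_inter_iff, Set.mem_union, Set.mem_ofPred_eq]
    rw [le_iff_lt_or_eq (a := |Q.2 - c (-1) / 2|)]
    tauto
  rw [this]
  refine (isClosed_le (by fun_prop) (by fun_prop)).inter
    ((isClosed_le (by fun_prop) (by fun_prop)).inter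
    ((isClosed_eq (by fun_prop) (by fun_prop)).union
    ((isClosed_le (by fun_prop) (by fun_prop)).inter hK)))

lemma localDirs_empty {g : ℕ} {c : ℤ → ℝ} (hc : Hyp g c) (Q : ℝ × ℝ) (hQ : Q ∉ Gam g c) :
    localDirs (Gam g c) Q = ∅ := by
  ext v
  simp only [Set.mem_empty_iff_false, iff_false]
  intro hv
  apply hQ
  have h := ((mem_localDirs _ _ _).1 hv).2
  have ht : Tendsto (fun t : ℝ => Q + t • vr v) (𝓝[>] 0) (𝓝 Q) := by
    have : Continuous fun t : ℝ => Q + t • vr v := by fun_prop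
    have h2 := this.tendsto 0
    simp only [zero_smul, add_zero] at h2
    exact h2.mono_left nhdsWithin_le_nhds
  exact (Gam_closed hc).mem_of_tendsto ht h

lemma dirs_horiz {g : ℕ} {c : ℤ → ℝ} (hc : Hyp g c) (Q : ℝ × ℝ) (hQ : Q ∈ Gam g c)
    (τ s : ℤ) (hτ : τ = 1 ∨ τ = -1) (hs : OneSided (Ptilde g c) Q.1 τ s)
    (v : ℤ × ℤ) (hv : v ∈ localDirs (Gam g c) Q) (hpos : 0 < τ * v.1) :
    |Q.2 - c (-1) / 2| = Ptilde g c Q.1 - c (-1) / 2 ∧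
    (∀ σ : ℤ, (σ = 1 ∨ σ = -1) → Q.2 - c (-1) / 2 = σ * (Ptilde g c Q.1 - c (-1) / 2) →
      v = (τ, σ * τ * s)) ∧
    (τ = 1 → Q.1 < 0) ∧ (τ = -1 → c 0 - c 1 < Q.1) := by
  have hττ : τ * τ = 1 := by rcases hτ with h | h <;> subst h <;> rfl
  obtain ⟨hcop, hev⟩ := (mem_localDirs _ _ _).1 hv
  obtain ⟨v1, v2⟩ := v
  obtain ⟨X, Y⟩ := Q
  simp only at hcop hpos hs ⊢
  obtain ⟨n, hn⟩ : ∃ n, n = τ * v1 := ⟨_, rfl⟩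
  have hv1 : v1 = τ * n := by rw [hn, ← mul_assoc, hττ, one_mul]
  rw [← hn] at hpos
  have hnR : (0 : ℝ) < n := by exact_mod_cast hpos
  have hv1R : (v1 : ℝ) = τ * n := by exact_mod_cast hv1
  have hτabs : |(τ : ℝ)| = 1 := by rcases hτ with h | h <;> subst h <;> simp
  obtain ⟨ε, hε, hs⟩ := hs
  obtain ⟨δ, hδ, hsep⟩ := kink_sep g c X
  have hp := Ptilde_pos hc X
  have E : ∀ᶠ t in 𝓝[>] (0 : ℝ), |Y + t * v2 - c (-1) / 2| =
      Ptilde g c X - c (-1) / 2 + τ * s * (t * n) ∧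
      c 0 - c 1 ≤ X + t * (τ * n) ∧ X + t * (τ * n) ≤ 0 := by
    filter_upwards [hev, ev_pos, ev_lt n ε hε, ev_lt n δ hδ] with t h1 h2 h3 h4
    rw [mem_Gam_iff hc] at h1
    simp only [vr, Prod.smul_mk, Prod.mk_add_mk, smul_eq_mul, hv1R] at h1
    obtain ⟨h5, h6, h7⟩ := h1
    have htn : 0 < t * n := by positivity
    refine ⟨?_, h5, h6⟩
    have hh := hs (t * n) htn.le h3
    have e : X + t * (τ * n) = X + τ * (t * n) := by ring
    rw [e] at h7
    have nk : ¬ Kink g c (X + τ * (t * n)) := by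
      intro hk
      have habs : |X + τ * (t * n) - X| = t * n := by
        rw [add_sub_cancel_left, abs_mul, hτabs, one_mul, abs_of_pos htn]
      have := hsep _ hk (by intro h; rw [h, sub_self, abs_zero] at habs; linarith)
      rw [habs] at this
      linarith
    rcases h7 with h7 | h7
    · rw [h7, hh]; ring
    · exact absurd h7.2 nk
  rw [mem_Gam_iff hc] at hQ
  simp only at hQ
  refine ⟨?_, ?_, ?_, ?_⟩
  · rcases hQ.2.2 with h | ⟨h, -⟩
    · exact h
    exfalso
    obtain ⟨t, ⟨h1, -⟩, h2, h3⟩ := (E.and (ev_pos.and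
      (ev_lt (|(v2 : ℝ)| + |(τ : ℝ) * s * n|) _ (sub_pos.2 h)))).exists
    have a1 : |Y + t * v2 - c (-1) / 2| ≤ |Y - c (-1) / 2| + t * |(v2 : ℝ)| := by
      have : Y + t * v2 - c (-1) / 2 = (Y - c (-1) / 2) + t * v2 := by ring
      rw [this]
      refine (abs_add_le _ _).trans ?_
      rw [abs_mul, abs_of_pos h2]
    have a2 := neg_abs_le ((τ : ℝ) * s * n)
    nlinarith
  · intro σ hσ hY
    have hσσ : (σ : ℝ) * σ = 1 := by rcases hσ with h | h <;> subst h <;> norm_num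
    have hσσZ : σ * σ = 1 := by rcases hσ with h | h <;> subst h <;> norm_num
    have hσabs : |(σ : ℝ)| = 1 := by rcases hσ with h | h <;> subst h <;> simp
    obtain ⟨t, ⟨h1, -⟩, h2, h3⟩ := (E.and (ev_pos.and (ev_lt (|(v2 : ℝ)|) _ hp))).exists
    have a1 : |Y + t * v2 - c (-1) / 2| = Ptilde g c X - c (-1) / 2 + t * (σ * v2) := by
      have : Y + t * v2 - c (-1) / 2 = σ * (Ptilde g c X - c (-1) / 2 + t * (σ * v2)) := by
        linear_combination hY - t * v2 * hσσ
      rw [this, abs_mul, hσabs, one_mul, abs_of_pos]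
      have := neg_abs_le ((σ : ℝ) * v2)
      rw [abs_mul, hσabs, one_mul] at this
      nlinarith
    rw [a1] at h1
    have h4 : t * ((σ : ℝ) * v2) = t * (τ * s * n) := by linarith
    have h5 := mul_left_cancel₀ h2.ne' h4
    have h6 : σ * v2 = τ * s * n := by exact_mod_cast h5
    have h7 : v2 = σ * τ * s * n := by
      calc v2 = σ * σ * v2 := by rw [hσσZ, one_mul]
        _ = σ * (σ * v2) := by ring
        _ = _ := by rw [h6]; ring
    have hu : IsUnit n := by
      apply hcop.isUnit_of_dvd' (x := n)
      · exact ⟨τ, by rw [hv1]; ring⟩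
      · exact ⟨σ * τ * s, by rw [h7]; ring⟩
    have hn1 : n = 1 := by
      rcases Int.isUnit_iff.1 hu with h | h <;> omega
    rw [hn1] at h7 hv1
    rw [h7, hv1]; simp
  · intro h
    obtain ⟨t, ⟨-, -, h1⟩, h2⟩ := (E.and ev_pos).exists
    subst h
    have : 0 < t * n := by positivity
    push_cast at h1
    linarith
  · intro h
    obtain ⟨t, ⟨-, h1, -⟩, h2⟩ := (E.and ev_pos).exists
    subst h
    have : 0 < t * n := by positivity
    push_cast at h1
    linarith

lemma dirs_horiz_mem {g : ℕ} {c : ℤ → ℝ} (hc : Hyp g c) (Q : ℝ × ℝ) (hQ : Q ∈ Gam g c)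
    (τ s σ : ℤ) (hτ : τ = 1 ∨ τ = -1) (hσ : σ = 1 ∨ σ = -1)
    (hs : OneSided (Ptilde g c) Q.1 τ s)
    (hY : Q.2 - c (-1) / 2 = σ * (Ptilde g c Q.1 - c (-1) / 2))
    (hx : (τ = 1 ∧ Q.1 < 0) ∨ (τ = -1 ∧ c 0 - c 1 < Q.1)) :
    (τ, σ * τ * s) ∈ localDirs (Gam g c) Q := by
  have hττ : τ * τ = 1 := by rcases hτ with h | h <;> subst h <;> rfl
  rw [mem_localDirs]
  refine ⟨⟨τ, 0, by simp [hττ]⟩, ?_⟩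
  obtain ⟨X, Y⟩ := Q
  obtain ⟨ε, hε, hs⟩ := hs
  rw [mem_Gam_iff hc] at hQ
  simp only at hQ hY hx hs
  have hσabs : |(σ : ℝ)| = 1 := by rcases hσ with h | h <;> subst h <;> simp
  have hstrip : ∀ᶠ t in 𝓝[>] (0 : ℝ), c 0 - c 1 ≤ X + t * τ ∧ X + t * τ ≤ 0 := by
    rcases hx with ⟨h, h'⟩ | ⟨h, h'⟩
    · filter_upwards [ev_pos, ev_lt 1 (-X) (by linarith)] with t h1 h2
      subst h
      push_cast
      constructor <;> linarith [hQ.1]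
    · filter_upwards [ev_pos, ev_lt 1 (X - (c 0 - c 1)) (by linarith)] with t h1 h2
      subst h
      push_cast
      constructor <;> linarith [hQ.2.1]
  filter_upwards [ev_pos, hstrip, ev_lt 1 ε hε] with t h1 h2 h3
  rw [mem_Gam_iff hc]
  simp only [vr, Prod.smul_mk, Prod.mk_add_mk, smul_eq_mul]
  refine ⟨h2.1, h2.2, Or.inl ?_⟩
  have hh := hs t h1.le (by linarith)
  have hp := Ptilde_pos hc (X + τ * t)
  rw [mul_comm t (τ : ℝ)]
  have : Y + t * ((σ * τ * s : ℤ) : ℝ) - c (-1) / 2 =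
      σ * (Ptilde g c (X + τ * t) - c (-1) / 2) := by
    rw [hh]; push_cast; linear_combination hY
  rw [this, abs_mul, hσabs, one_mul, abs_of_pos hp]

lemma coprime_zero (v : ℤ × ℤ) (h : IsCoprime v.1 v.2) (h0 : v.1 = 0) :
    v.2 = 1 ∨ v.2 = -1 := by
  rw [h0, isCoprime_zero_left] at h
  exact Int.isUnit_iff.1 h

lemma dirs_vert_top {g : ℕ} {c : ℤ → ℝ} (hc : Hyp g c) (Q : ℝ × ℝ)
    (σ e : ℤ) (hσ : σ = 1 ∨ σ = -1) (he : e = 1 ∨ e = -1)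
    (hY : Q.2 - c (-1) / 2 = σ * (Ptilde g c Q.1 - c (-1) / 2))
    (hv : (0, e) ∈ localDirs (Gam g c) Q) : e = -σ ∧ Kink g c Q.1 := by
  obtain ⟨-, hev⟩ := (mem_localDirs _ _ _).1 hv
  obtain ⟨X, Y⟩ := Q
  simp only at hY ⊢
  have hp := Ptilde_pos hc X
  have hσabs : |(σ : ℝ)| = 1 := by rcases hσ with h | h <;> subst h <;> simp
  obtain ⟨t, h1, h2, h3⟩ := (hev.and (ev_pos.and (ev_lt 1 _ hp))).exists
  rw [mem_Gam_iff hc] at h1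
  simp only [vr, Prod.smul_mk, Prod.mk_add_mk, smul_eq_mul, Int.cast_zero, mul_zero,
    add_zero] at h1
  have h4 := h1.2.2
  by_cases hes : e = σ
  · exfalso
    have : Y + t * e - c (-1) / 2 = σ * (Ptilde g c X - c (-1) / 2 + t) := by
      rw [hes]; linear_combination hY
    rw [this, abs_mul, hσabs, one_mul, abs_of_pos (by linarith)] at h4
    rcases h4 with h | ⟨h, -⟩ <;> linarith
  · have hes' : e = -σ := by omega
    refine ⟨hes', ?_⟩
    have : Y + t * e - c (-1) / 2 = σ * (Ptilde g c X - c (-1) / 2 - t) := by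
      rw [hes']; push_cast; linear_combination hY
    rw [this, abs_mul, hσabs, one_mul, abs_of_pos (by linarith)] at h4
    rcases h4 with h | ⟨-, h⟩
    · linarith
    · exact h

lemma dirs_vert_mem {g : ℕ} {c : ℤ → ℝ} (hc : Hyp g c) (Q : ℝ × ℝ) (hQ : Q ∈ Gam g c)
    (e : ℤ) (he : e = 1 ∨ e = -1) (hk : Kink g c Q.1)
    (hlt : ∀ᶠ t in 𝓝[>] (0 : ℝ),
      |Q.2 - c (-1) / 2 + t * e| < Ptilde g c Q.1 - c (-1) / 2) :
    (0, e) ∈ localDirs (Gam g c) Q := by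
  rw [mem_localDirs]
  refine ⟨isCoprime_zero_left.2 (Int.isUnit_iff.2 he), ?_⟩
  obtain ⟨X, Y⟩ := Q
  rw [mem_Gam_iff hc] at hQ
  filter_upwards [hlt] with t h1
  rw [mem_Gam_iff hc]
  simp only [vr, Prod.smul_mk, Prod.mk_add_mk, smul_eq_mul, Int.cast_zero, mul_zero, add_zero]
  refine ⟨hQ.1, hQ.2.1, Or.inr ⟨?_, hk⟩⟩
  have : Y + t * e - c (-1) / 2 = Y - c (-1) / 2 + t * e := by ring
  rw [this]
  exact h1

lemma localDirs_top {g : ℕ} {c : ℤ → ℝ} (hc : Hyp g c) (Q : ℝ × ℝ) (hQ : Q ∈ Gam g c)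
    (σ sR sL : ℤ) (hσ : σ = 1 ∨ σ = -1)
    (hY : Q.2 - c (-1) / 2 = σ * (Ptilde g c Q.1 - c (-1) / 2))
    (hR : OneSided (Ptilde g c) Q.1 1 sR) (hL : OneSided (Ptilde g c) Q.1 (-1) sL) :
    localDirs (Gam g c) Q = {v | (v = (1, σ * 1 * sR) ∧ Q.1 < 0) ∨
      (v = (-1, σ * (-1) * sL) ∧ c 0 - c 1 < Q.1) ∨ (v = (0, -σ) ∧ Kink g c Q.1)} := by
  ext v
  simp only [Set.mem_ofPred_eq]
  constructor
  · intro hv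
    rcases lt_trichotomy v.1 0 with h | h | h
    · obtain ⟨-, h2, -, h4⟩ := dirs_horiz hc Q hQ (-1) sL (Or.inr rfl) hL v hv (by omega)
      exact Or.inr (Or.inl ⟨h2 σ hσ hY, h4 rfl⟩)
    · have he := coprime_zero v hv.1 h
      have hv' : v = (0, v.2) := Prod.ext h rfl
      rw [hv'] at hv
      obtain ⟨h1, h2⟩ := dirs_vert_top hc Q σ v.2 hσ he hY hv
      exact Or.inr (Or.inr ⟨by rw [hv', h1], h2⟩)
    · obtain ⟨-, h2, h3, -⟩ := dirs_horiz hc Q hQ 1 sR (Or.inl rfl) hR v hv (by omega)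
      exact Or.inl ⟨h2 σ hσ hY, h3 rfl⟩
  · rintro (⟨rfl, h⟩ | ⟨rfl, h⟩ | ⟨rfl, h⟩)
    · exact dirs_horiz_mem hc Q hQ 1 sR σ (Or.inl rfl) hσ hR hY (Or.inl ⟨rfl, h⟩)
    · exact dirs_horiz_mem hc Q hQ (-1) sL σ (Or.inr rfl) hσ hL hY (Or.inr ⟨rfl, h⟩)
    · apply dirs_vert_mem hc Q hQ (-σ) (by omega) h
      have hp := Ptilde_pos hc Q.1
      have hσabs : |(σ : ℝ)| = 1 := by rcases hσ with h | h <;> subst h <;> simp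
      filter_upwards [ev_pos, ev_lt 1 _ hp] with t h1 h2
      have : Q.2 - c (-1) / 2 + t * ((-σ : ℤ) : ℝ) = σ * (Ptilde g c Q.1 - c (-1) / 2 - t) := by
        rw [hY]; push_cast; ring
      rw [this, abs_mul, hσabs, one_mul, abs_of_pos (by linarith)]
      linarith

lemma localDirs_int {g : ℕ} {c : ℤ → ℝ} (hc : Hyp g c) (Q : ℝ × ℝ) (hQ : Q ∈ Gam g c)
    (hlt : |Q.2 - c (-1) / 2| < Ptilde g c Q.1 - c (-1) / 2) :
    localDirs (Gam g c) Q = {(0, 1), (0, -1)} := by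
  have hk : Kink g c Q.1 := by
    rcases ((mem_Gam_iff hc Q).1 hQ).2.2 with h | h
    · linarith
    · exact h.2
  ext v
  simp only [Set.mem_insert_iff, Set.mem_singleton_iff]
  constructor
  · intro hv
    rcases lt_trichotomy v.1 0 with h | h | h
    · obtain ⟨s, hs⟩ := Ptilde_oneSided g c Q.1 (-1) (Or.inr rfl)
      obtain ⟨h1, -⟩ := dirs_horiz hc Q hQ (-1) s (Or.inr rfl) hs v hv (by omega)
      linarith
    · rcases coprime_zero v hv.1 h with he | he
      · exact Or.inl (Prod.ext h he)
      · exact Or.inr (Prod.ext h he)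
    · obtain ⟨s, hs⟩ := Ptilde_oneSided g c Q.1 1 (Or.inl rfl)
      obtain ⟨h1, -⟩ := dirs_horiz hc Q hQ 1 s (Or.inl rfl) hs v hv (by omega)
      linarith
  · have key : ∀ e : ℤ, (e = 1 ∨ e = -1) → (0, e) ∈ localDirs (Gam g c) Q := by
      intro e he
      apply dirs_vert_mem hc Q hQ e he hk
      have heabs : |(e : ℝ)| = 1 := by rcases he with h | h <;> subst h <;> simp
      filter_upwards [ev_pos, ev_lt 1 _ (sub_pos.2 hlt)] with t h1 h2
      refine (abs_add_le _ _).trans_lt ?_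
      rw [abs_mul, heabs, abs_of_pos h1]
      linarith
    rintro (rfl | rfl)
    · exact key 1 (Or.inl rfl)
    · exact key (-1) (Or.inr rfl)

lemma localDirs_finite {g : ℕ} {c : ℤ → ℝ} (hc : Hyp g c) (Q : ℝ × ℝ) :
    (localDirs (Gam g c) Q).Finite := by
  by_cases hQ : Q ∈ Gam g c
  · rcases ((mem_Gam_iff hc Q).1 hQ).2.2 with h | h
    · obtain ⟨sR, hR⟩ := Ptilde_oneSided g c Q.1 1 (Or.inl rfl)
      obtain ⟨sL, hL⟩ := Ptilde_oneSided g c Q.1 (-1) (Or.inr rfl)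
      have hσ : ∃ σ : ℤ, (σ = 1 ∨ σ = -1) ∧
          Q.2 - c (-1) / 2 = σ * (Ptilde g c Q.1 - c (-1) / 2) := by
        rcases abs_choice (Q.2 - c (-1) / 2) with h' | h'
        · exact ⟨1, Or.inl rfl, by push_cast; linarith⟩
        · exact ⟨-1, Or.inr rfl, by push_cast; linarith⟩
      obtain ⟨σ, hσ, hY⟩ := hσ
      rw [localDirs_top hc Q hQ σ sR sL hσ hY hR hL]
      apply Set.Finite.subset
        (Set.toFinite {((1 : ℤ), σ * 1 * sR), (-1, σ * (-1) * sL), (0, -σ)})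
      rintro v (⟨rfl, h⟩ | ⟨rfl, h⟩ | ⟨rfl, h⟩) <;> simp
    · rw [localDirs_int hc Q hQ h.1]
      exact Set.toFinite _
  · rw [localDirs_empty hc Q hQ]
    exact Set.finite_empty

lemma finsum_three (f : ℤ × ℤ → ℤ) (a b d : ℤ × ℤ) (A B D : Prop) [Decidable A] [Decidable B]
    [Decidable D] (hab : a ≠ b) (had : a ≠ d) (hbd : b ≠ d) :
    ∑ᶠ v ∈ {v | (v = a ∧ A) ∨ (v = b ∧ B) ∨ (v = d ∧ D)}, f v =
      (if A then f a else 0) + (if B then f b else 0) + (if D then f d else 0) := by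
  have : {v | (v = a ∧ A) ∨ (v = b ∧ B) ∨ (v = d ∧ D)} =
      (({a, b, d} : Finset (ℤ × ℤ)).filter
        (fun v => (v = a ∧ A) ∨ (v = b ∧ B) ∨ (v = d ∧ D)) : Set (ℤ × ℤ)) := by
    ext v
    simp
    tauto
  rw [this, finsum_mem_coe_finset, Finset.sum_filter]
  rw [Finset.sum_insert (by simp [hab, had]), Finset.sum_insert (by simp [hbd]),
    Finset.sum_singleton]
  simp [hab, had, hbd, hab.symm, had.symm, hbd.symm]
  ring

end TropicalHyperelliptic

namespace TropicalHyperelliptic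

open Filter Topology

open scoped Classical in
noncomputable def hfun (g : ℕ) (c : ℤ → ℝ) (A : ℝ × ℝ) (Q : ℝ × ℝ) : ℝ :=
  max Q.1 A.1 + if Q.1 = A.1 then
    max |Q.2 - c (-1) / 2| |A.2 - c (-1) / 2| - (Ptilde g c A.1 - c (-1) / 2) else 0

lemma hfun_cont {g : ℕ} {c : ℤ → ℝ} (hc : Hyp g c) (A : ℝ × ℝ) (hA : A ∈ Gam g c) :
    ContinuousOn (hfun g c A) (Gam g c) := by
  obtain ⟨δ, hδ, hsep⟩ := kink_sep g c A.1
  have hcont := Ptilde_cont g c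
  set d := Ptilde g c A.1 - c (-1) / 2 - |A.2 - c (-1) / 2| with hd
  have hA' := ((mem_Gam_iff hc A).1 hA).2.2
  have hd0 : 0 ≤ d := by
    rcases hA' with h | h
    · linarith
    · linarith [h.1]
  have hG : Continuous fun Q : ℝ × ℝ => max Q.1 A.1 - max 0
      (min (Ptilde g c Q.1 - c (-1) / 2 - |Q.2 - c (-1) / 2|) d - d / δ * |Q.1 - A.1|) := by
    fun_prop
  refine hG.continuousOn.congr ?_
  intro Q hQ
  have hQ' := ((mem_Gam_iff hc Q).1 hQ).2.2
  have hu0 : 0 ≤ Ptilde g c Q.1 - c (-1) / 2 - |Q.2 - c (-1) / 2| := by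
    rcases hQ' with h | h
    · linarith
    · linarith [h.1]
  unfold hfun
  split_ifs with h
  · simp only [h, sub_self, abs_zero, mul_zero, sub_zero]
    rw [h] at hu0
    rw [max_eq_right (le_min hu0 hd0)]
    rcases le_total |Q.2 - c (-1) / 2| |A.2 - c (-1) / 2| with h1 | h1
    · rw [max_eq_right h1, min_eq_right (by linarith)]; linarith
    · rw [max_eq_left h1, min_eq_left (by linarith)]; linarith
  · simp only [add_zero]
    have hdd : 0 ≤ d / δ := by positivity
    have hm : min (Ptilde g c Q.1 - c (-1) / 2 - |Q.2 - c (-1) / 2|) d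
        - d / δ * |Q.1 - A.1| ≤ 0 := by
      rcases hQ' with h1 | ⟨-, h1⟩
      · rw [h1, sub_self]
        have := min_le_left 0 d
        have := abs_nonneg (Q.1 - A.1)
        nlinarith
      · have h2 := hsep _ h1 h
        have h3 : d / δ * δ ≤ d / δ * |Q.1 - A.1| := mul_le_mul_of_nonneg_left h2 hdd
        rw [div_mul_cancel₀ _ hδ.ne'] at h3
        have := min_le_right (Ptilde g c Q.1 - c (-1) / 2 - |Q.2 - c (-1) / 2|) d
        linarith
    rw [max_eq_left hm, sub_zero]

lemma hfun_top {g : ℕ} {c : ℤ → ℝ} (A Q : ℝ × ℝ)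
    (hA : |A.2 - c (-1) / 2| ≤ Ptilde g c A.1 - c (-1) / 2)
    (hQ : |Q.2 - c (-1) / 2| = Ptilde g c Q.1 - c (-1) / 2) :
    hfun g c A Q = max Q.1 A.1 := by
  unfold hfun
  split_ifs with h
  · rw [h] at hQ
    rw [hQ, max_eq_left hA]; ring
  · ring

lemma slope_right {g : ℕ} {c : ℤ → ℝ} (A Q : ℝ × ℝ)
    (hA : |A.2 - c (-1) / 2| ≤ Ptilde g c A.1 - c (-1) / 2)
    (hQ : |Q.2 - c (-1) / 2| = Ptilde g c Q.1 - c (-1) / 2) (m : ℤ) :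
    HasSlope (Gam g c) (hfun g c A) Q (1, m) (if A.1 ≤ Q.1 then 1 else 0) := by
  apply hasSlope_of_ev
  rw [hfun_top A Q hA hQ]
  split_ifs with h
  · filter_upwards [ev_pos] with t ht
    unfold hfun
    simp only [vr, Prod.fst_add, Prod.smul_fst, smul_eq_mul, Int.cast_one, mul_one, one_mul]
    rw [if_neg (by linarith), max_eq_left h, max_eq_left (by linarith)]; ring
  · push Not at h
    filter_upwards [ev_pos, ev_lt 1 (A.1 - Q.1) (by linarith)] with t ht h2
    unfold hfun
    simp only [vr, Prod.fst_add, Prod.smul_fst, smul_eq_mul, Int.cast_one, mul_one, Int.cast_zero,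
      zero_mul]
    rw [if_neg (by linarith), max_eq_right h.le, max_eq_right (by linarith)]

lemma slope_left {g : ℕ} {c : ℤ → ℝ} (A Q : ℝ × ℝ)
    (hA : |A.2 - c (-1) / 2| ≤ Ptilde g c A.1 - c (-1) / 2)
    (hQ : |Q.2 - c (-1) / 2| = Ptilde g c Q.1 - c (-1) / 2) (m : ℤ) :
    HasSlope (Gam g c) (hfun g c A) Q (-1, m) (if A.1 < Q.1 then -1 else 0) := by
  apply hasSlope_of_ev
  rw [hfun_top A Q hA hQ]
  split_ifs with h
  · filter_upwards [ev_pos, ev_lt 1 (Q.1 - A.1) (by linarith)] with t ht h2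
    unfold hfun
    simp only [vr, Prod.fst_add, Prod.smul_fst, smul_eq_mul, Int.cast_neg, Int.cast_one]
    rw [if_neg (by linarith), max_eq_left h.le, max_eq_left (by linarith)]; ring
  · push Not at h
    filter_upwards [ev_pos] with t ht
    unfold hfun
    simp only [vr, Prod.fst_add, Prod.smul_fst, smul_eq_mul, Int.cast_neg, Int.cast_one,
      Int.cast_zero, zero_mul]
    rw [if_neg (by linarith), max_eq_right h, max_eq_right (by linarith)]

lemma slope_vert_ne {g : ℕ} {c : ℤ → ℝ} (A Q : ℝ × ℝ) (h : Q.1 ≠ A.1) (e : ℤ) :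
    HasSlope (Gam g c) (hfun g c A) Q (0, e) 0 := by
  apply hasSlope_of_ev
  filter_upwards with t
  unfold hfun
  simp [vr, h]

lemma slope_vert_eq {g : ℕ} {c : ℤ → ℝ} (A Q : ℝ × ℝ) (h : Q.1 = A.1) (e r : ℤ)
    (hr : ∀ᶠ t in 𝓝[>] (0 : ℝ), max |Q.2 - c (-1) / 2 + t * e| |A.2 - c (-1) / 2| =
      max |Q.2 - c (-1) / 2| |A.2 - c (-1) / 2| + r * t) :
    HasSlope (Gam g c) (hfun g c A) Q (0, e) r := by
  apply hasSlope_of_ev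
  filter_upwards [hr] with t ht
  unfold hfun
  simp only [vr, Prod.fst_add, Prod.snd_add, Prod.smul_fst, Prod.smul_snd, smul_eq_mul,
    Int.cast_zero, mul_zero, add_zero, h, if_true]
  have : Q.2 + t * e - c (-1) / 2 = Q.2 - c (-1) / 2 + t * e := by ring
  rw [this, ht]; ring

open scoped Classical in
lemma one_dim (y b : ℝ) : ∃ r1 r2 : ℤ,
    (∀ᶠ t in 𝓝[>] (0 : ℝ), max |y + t * ((1 : ℤ) : ℝ)| |b| = max |y| |b| + r1 * t) ∧
    (∀ᶠ t in 𝓝[>] (0 : ℝ), max |y + t * ((-1 : ℤ) : ℝ)| |b| = max |y| |b| + r2 * t) ∧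
    r1 + r2 = (if y = b then 1 else 0) + (if y = -b then 1 else 0) := by
  rcases lt_trichotomy |y| |b| with h | h | h
  · refine ⟨0, 0, ?_, ?_, ?_⟩
    · filter_upwards [ev_pos, ev_lt 1 _ (sub_pos.2 h)] with t h1 h2
      rw [max_eq_right h.le, max_eq_right]
      · simp
      · refine (abs_add_le _ _).trans ?_
        simp [abs_of_pos h1]; linarith
    · filter_upwards [ev_pos, ev_lt 1 _ (sub_pos.2 h)] with t h1 h2
      rw [max_eq_right h.le, max_eq_right]
      · simp
      · refine (abs_add_le _ _).trans ?_
        simp [abs_of_pos h1]; linarith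
    · rw [if_neg (by rintro rfl; simp at h), if_neg (by rintro rfl; simp at h)]
      try rfl
  · rw [← h]
    have hyb := abs_eq_abs.1 h
    rcases lt_trichotomy y 0 with h0 | h0 | h0
    · refine ⟨0, 1, ?_, ?_, ?_⟩
      · filter_upwards [ev_pos, ev_lt 1 (-y) (by linarith)] with t h1 h2
        push_cast
        rw [abs_of_neg h0, abs_of_neg (by linarith), max_self, max_eq_right (by linarith)]; ring
      · filter_upwards [ev_pos] with t h1
        push_cast
        rw [abs_of_neg h0, abs_of_neg (by linarith), max_self, max_eq_left (by linarith)]; ring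
      · rcases hyb with hb | hb
        · rw [if_pos hb, if_neg (by intro h'; linarith)] <;> rfl
        · rw [if_pos hb, if_neg (by intro h'; linarith)] <;> rfl
    · refine ⟨1, 1, ?_, ?_, ?_⟩
      · filter_upwards [ev_pos] with t h1
        simp [h0, abs_of_pos h1, h1.le]
      · filter_upwards [ev_pos] with t h1
        simp [h0, abs_of_pos h1, h1.le]
      · have hb : b = 0 := by rw [h0, abs_zero] at h; exact abs_eq_zero.1 h.symm
        simp [hb, h0]
    · refine ⟨1, 0, ?_, ?_, ?_⟩
      · filter_upwards [ev_pos] with t h1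
        push_cast
        rw [abs_of_pos h0, abs_of_pos (by linarith), max_self, max_eq_left (by linarith)]; ring
      · filter_upwards [ev_pos, ev_lt 1 y (by linarith)] with t h1 h2
        push_cast
        rw [abs_of_pos h0, abs_of_pos (by linarith), max_self, max_eq_right (by linarith)]; ring
      · rcases hyb with hb | hb
        · rw [if_pos hb, if_neg (by intro h'; linarith)] <;> rfl
        · rw [if_pos hb, if_neg (by intro h'; linarith)] <;> rfl
  · have hne : (if y = b then (1 : ℤ) else 0) + (if y = -b then 1 else 0) = 0 := by
      rw [if_neg, if_neg]
      · rfl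
      · rintro rfl; simp at h
      · rintro rfl; simp at h
    rw [hne]
    have hb := abs_nonneg b
    rcases lt_trichotomy y 0 with h0 | h0 | h0
    · rw [abs_of_neg h0] at h ⊢
      refine ⟨-1, 1, ?_, ?_, rfl⟩
      · filter_upwards [ev_pos, ev_lt 1 (-y - |b|) (by linarith)] with t h1 h2
        push_cast
        rw [abs_of_neg (by linarith), max_eq_left h.le, max_eq_left (by linarith)]; ring
      · filter_upwards [ev_pos] with t h1
        push_cast
        rw [abs_of_neg (by linarith), max_eq_left h.le, max_eq_left (by linarith)]; ring
    · rw [h0, abs_zero] at h; linarith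
    · rw [abs_of_pos h0] at h ⊢
      refine ⟨1, -1, ?_, ?_, rfl⟩
      · filter_upwards [ev_pos] with t h1
        push_cast
        rw [abs_of_pos (by linarith), max_eq_left h.le, max_eq_left (by linarith)]; ring
      · filter_upwards [ev_pos, ev_lt 1 (y - |b|) (by linarith)] with t h1 h2
        push_cast
        rw [abs_of_pos (by linarith), max_eq_left h.le, max_eq_left (by linarith)]; ring

open scoped Classical in
lemma top_dim (p b : ℝ) (σ : ℤ) (hσ : σ = 1 ∨ σ = -1) (hp : 0 < p) (hb : |b| ≤ p) :
    (∀ᶠ t in 𝓝[>] (0 : ℝ), max |σ * p + t * ((-σ : ℤ) : ℝ)| |b| =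
      max |σ * p| |b| + ((if |b| = p then 0 else -1 : ℤ) : ℝ) * t) := by
  have hσabs : |(σ : ℝ)| = 1 := by rcases hσ with h | h <;> subst h <;> simp
  have e1 : |σ * p| = p := by rw [abs_mul, hσabs, one_mul, abs_of_pos hp]
  have e2 : ∀ t : ℝ, t < p → |σ * p + t * ((-σ : ℤ) : ℝ)| = p - t := by
    intro t ht
    have : σ * p + t * ((-σ : ℤ) : ℝ) = σ * (p - t) := by push_cast; ring
    rw [this, abs_mul, hσabs, one_mul, abs_of_pos (by linarith)]
  split_ifs with h
  · filter_upwards [ev_pos, ev_lt 1 p hp] with t h1 h2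
    rw [e2 t (by linarith), e1, h, max_self, max_eq_right (by linarith)]; simp
  · have h' := lt_of_le_of_ne hb h
    filter_upwards [ev_pos, ev_lt 1 p hp, ev_lt 1 (p - |b|) (by linarith)] with t h1 h2 h3
    rw [e2 t (by linarith), e1, max_eq_left hb, max_eq_left (by linarith)]; push_cast; ring

/-- the divisor of a conjugate pair minus the base pair -/
noncomputable def pairDiv (g : ℕ) (c : ℤ → ℝ) (A : ℝ × ℝ) : Div :=
  (Finsupp.single A (1 : ℤ) + Finsupp.single (conj c A) (1 : ℤ))
    - (Finsupp.single (V g c 0) (1 : ℤ) + Finsupp.single (conj c (V g c 0)) (1 : ℤ))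

open scoped Classical in
lemma pair_apply (c : ℤ → ℝ) (A Q : ℝ × ℝ) :
    (Finsupp.single A (1 : ℤ) + Finsupp.single (conj c A) (1 : ℤ) : Div) Q =
    if Q.1 = A.1 then
      (if Q.2 - c (-1) / 2 = A.2 - c (-1) / 2 then 1 else 0) +
      (if Q.2 - c (-1) / 2 = -(A.2 - c (-1) / 2) then 1 else 0) else 0 := by
  rw [Finsupp.add_apply, Finsupp.single_apply, Finsupp.single_apply]
  have e1 : A = Q ↔ Q.1 = A.1 ∧ Q.2 - c (-1) / 2 = A.2 - c (-1) / 2 := by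
    rw [Prod.ext_iff]
    constructor
    · rintro ⟨h1, h2⟩; exact ⟨h1.symm, by rw [h2]⟩
    · rintro ⟨h1, h2⟩; exact ⟨h1.symm, by linarith⟩
  have e2 : conj c A = Q ↔ Q.1 = A.1 ∧ Q.2 - c (-1) / 2 = -(A.2 - c (-1) / 2) := by
    rw [Prod.ext_iff]
    simp only [conj]
    constructor
    · rintro ⟨h1, h2⟩; exact ⟨h1.symm, by linarith⟩
    · rintro ⟨h1, h2⟩; exact ⟨h1.symm, by linarith⟩
  simp only [e1, e2]
  by_cases h : Q.1 = A.1 <;> simp [h]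

lemma V_zero {g : ℕ} {c : ℤ → ℝ} (hc : Hyp g c) : V g c 0 = (0, 0) := by
  unfold V
  simp [hc.1, hc.2.1]

open scoped Classical in
/-- at a top point, the count of the conjugate pair at that point -/
lemma top_count (y b p : ℝ) (σ : ℤ) (hσ : σ = 1 ∨ σ = -1) (hp : 0 < p) (hy : y = σ * p) :
    (if y = b then (1 : ℤ) else 0) + (if y = -b then 1 else 0) = if |b| = p then 1 else 0 := by
  by_cases h : |b| = p
  · rw [if_pos h]
    rcases hσ with rfl | rfl <;> push_cast at hy <;>
      rcases abs_choice b with h' | h' <;> rw [h'] at h <;> split_ifs <;>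
      first
        | rfl
        | (exfalso; linarith)
        | (exfalso; exact (‹¬ y = b›) (by linarith))
        | (exfalso; exact (‹¬ y = -b›) (by linarith))
  · rw [if_neg h, if_neg, if_neg]
    · rfl
    all_goals
      intro h'
      apply h
      rcases hσ with rfl | rfl <;> push_cast at hy
    · rw [show b = -p by linarith, abs_neg, abs_of_pos hp]
    · rw [show b = p by linarith, abs_of_pos hp]
    · rw [show b = p by linarith, abs_of_pos hp]
    · rw [show b = -p by linarith, abs_neg, abs_of_pos hp]

lemma hfun_main {g : ℕ} {c : ℤ → ℝ} (hc : Hyp g c) (A : ℝ × ℝ) (hA : A ∈ Gam g c) :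
    IsRationalFn (Gam g c) (hfun g c A) ∧
      ∀ Q, pairDiv g c A Q = ord (Gam g c) (hfun g c A) Q := by
  classical
  obtain ⟨hA1, hA2, hA3⟩ := (mem_Gam_iff hc A).1 hA
  have hAle : |A.2 - c (-1) / 2| ≤ Ptilde g c A.1 - c (-1) / 2 := by
    rcases hA3 with h | h
    · exact h.le
    · exact h.1.le
  have hP0 := Ptilde_zero hc
  have key : ∀ Q, (Q ∈ Gam g c → ∀ v ∈ localDirs (Gam g c) Q,
      ∃ s : ℤ, HasSlope (Gam g c) (hfun g c A) Q v s) ∧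
      pairDiv g c A Q = ord (Gam g c) (hfun g c A) Q := by
    intro Q
    have hD : pairDiv g c A Q = (if Q.1 = A.1 then
      (if Q.2 - c (-1) / 2 = A.2 - c (-1) / 2 then 1 else 0) +
      (if Q.2 - c (-1) / 2 = -(A.2 - c (-1) / 2) then 1 else 0) else 0) -
      (if Q.1 = 0 then
      (if Q.2 - c (-1) / 2 = 0 - c (-1) / 2 then 1 else 0) +
      (if Q.2 - c (-1) / 2 = -(0 - c (-1) / 2) then 1 else 0) else 0) := by
      unfold pairDiv
      rw [Finsupp.sub_apply, pair_apply, pair_apply, V_zero hc]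
    have hp := Ptilde_pos hc Q.1
    by_cases hQ : Q ∈ Gam g c
    · obtain ⟨hQ1, hQ2, hQ3⟩ := (mem_Gam_iff hc Q).1 hQ
      rcases hQ3 with h | ⟨h, hk⟩
      · -- top or bottom point
        obtain ⟨sR, hR⟩ := Ptilde_oneSided g c Q.1 1 (Or.inl rfl)
        obtain ⟨sL, hL⟩ := Ptilde_oneSided g c Q.1 (-1) (Or.inr rfl)
        have hσ : ∃ σ : ℤ, (σ = 1 ∨ σ = -1) ∧
            Q.2 - c (-1) / 2 = σ * (Ptilde g c Q.1 - c (-1) / 2) := by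
          rcases abs_choice (Q.2 - c (-1) / 2) with h' | h'
          · exact ⟨1, Or.inl rfl, by push_cast; linarith⟩
          · exact ⟨-1, Or.inr rfl, by push_cast; linarith⟩
        obtain ⟨σ, hσ, hY⟩ := hσ
        have hdirs := localDirs_top hc Q hQ σ sR sL hσ hY hR hL
        have S1 := slope_right A Q hAle h (σ * 1 * sR)
        have S2 := slope_left A Q hAle h (σ * (-1) * sL)
        have S3 : HasSlope (Gam g c) (hfun g c A) Q (0, -σ)
            (if Q.1 = A.1 then
              (if |A.2 - c (-1) / 2| = Ptilde g c Q.1 - c (-1) / 2 then 0 else -1) else 0) := by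
          by_cases hx : Q.1 = A.1
          · rw [if_pos hx]
            apply slope_vert_eq A Q hx
            rw [hY]
            exact top_dim _ _ σ hσ hp (by rw [hx]; exact hAle)
          · rw [if_neg hx]
            exact slope_vert_ne A Q hx _
        refine ⟨fun _ v hv => ?_, ?_⟩
        · rw [hdirs] at hv
          rcases hv with ⟨rfl, -⟩ | ⟨rfl, -⟩ | ⟨rfl, -⟩
          · exact ⟨_, S1⟩
          · exact ⟨_, S2⟩
          · exact ⟨_, S3⟩
        · have T1 : Q.1 < 0 → slope (Gam g c) (hfun g c A) Q (1, σ * 1 * sR) =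
              (if A.1 ≤ Q.1 then 1 else 0) := fun hh =>
            slope_eq (by rw [hdirs]; exact Or.inl ⟨rfl, hh⟩) S1
          have T2 : c 0 - c 1 < Q.1 → slope (Gam g c) (hfun g c A) Q (-1, σ * (-1) * sL) =
              (if A.1 < Q.1 then -1 else 0) := fun hh =>
            slope_eq (by rw [hdirs]; exact Or.inr (Or.inl ⟨rfl, hh⟩)) S2
          have T3 : Kink g c Q.1 → slope (Gam g c) (hfun g c A) Q (0, -σ) = _ := fun hh =>
            slope_eq (by rw [hdirs]; exact Or.inr (Or.inr ⟨rfl, hh⟩)) S3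
          have hord : ord (Gam g c) (hfun g c A) Q =
              (if Q.1 < 0 then (if A.1 ≤ Q.1 then 1 else 0) else 0) +
              (if c 0 - c 1 < Q.1 then (if A.1 < Q.1 then -1 else 0) else 0) +
              (if Kink g c Q.1 then (if Q.1 = A.1 then
              (if |A.2 - c (-1) / 2| = Ptilde g c Q.1 - c (-1) / 2 then 0 else -1) else 0)
                else 0) := by
            unfold ord
            rw [hdirs, finsum_three _ _ _ _ _ _ _ (by simp) (by simp) (by simp)]
            congr 1
            · congr 1
              · split_ifs <;> first | rfl | (rw [T1 ‹_›]; simp [*])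
              · split_ifs <;> first | rfl | (rw [T2 ‹_›]; simp [*])
            · by_cases hh : Kink g c Q.1
              · rw [if_pos hh, if_pos hh, T3 hh]
              · rw [if_neg hh, if_neg hh]
          rw [hord, hD, top_count _ _ _ σ hσ hp hY, top_count _ _ _ σ hσ hp hY]
          have hz : (if Q.1 = 0 then (if |0 - c (-1) / 2| = Ptilde g c Q.1 - c (-1) / 2
              then (1 : ℤ) else 0) else 0) = if Q.1 = 0 then 1 else 0 := by
            by_cases h0 : Q.1 = 0
            · rw [if_pos h0, if_pos h0, if_pos]
              rw [h0] at hp ⊢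
              rw [hP0] at hp ⊢
              exact abs_of_pos hp
            · rw [if_neg h0, if_neg h0]
          rw [hz]
          rcases lt_trichotomy Q.1 A.1 with hlt | heq | hgt
          · rw [if_neg hlt.ne, if_neg (show Q.1 ≠ 0 by linarith),
              if_neg (not_le.2 hlt), if_neg (not_lt.2 hlt.le), if_neg hlt.ne]
            simp
          · rw [if_pos heq, if_pos heq.ge, if_neg (not_lt.2 heq.le), if_pos heq]
            have hkk : |A.2 - c (-1) / 2| ≠ Ptilde g c Q.1 - c (-1) / 2 → Kink g c Q.1 := by
              intro hne
              rw [heq] at hne ⊢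
              rcases hA3 with h' | h'
              · exact absurd h' hne
              · exact h'.2
            have hlast : (if Kink g c Q.1 then (if |A.2 - c (-1) / 2| =
                Ptilde g c Q.1 - c (-1) / 2 then (0 : ℤ) else -1) else 0) =
                (if |A.2 - c (-1) / 2| = Ptilde g c Q.1 - c (-1) / 2 then (0 : ℤ) else -1) := by
              by_cases hh : |A.2 - c (-1) / 2| = Ptilde g c Q.1 - c (-1) / 2
              · simp [hh]
              · rw [if_pos (hkk hh)]
            rw [hlast]
            rcases hQ2.eq_or_lt with h0 | h0
            · rw [if_pos h0, if_neg (show ¬ Q.1 < 0 by linarith)]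
              split_ifs <;> simp
            · rw [if_neg h0.ne, if_pos h0]
              split_ifs <;> simp
          · rw [if_neg hgt.ne', if_pos hgt.le, if_pos (lt_of_le_of_lt hA1 hgt), if_pos hgt,
              if_neg hgt.ne']
            rcases hQ2.eq_or_lt with h0 | h0
            · rw [if_pos h0, if_neg (show ¬ Q.1 < 0 by linarith)]
              simp
            · rw [if_neg h0.ne, if_pos h0]
              simp
      · -- interior point of a vertical edge
        have hdirs := localDirs_int hc Q hQ h
        obtain ⟨r1, r2, R1, R2, hr⟩ : ∃ r1 r2 : ℤ,
            HasSlope (Gam g c) (hfun g c A) Q (0, 1) r1 ∧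
            HasSlope (Gam g c) (hfun g c A) Q (0, -1) r2 ∧
            r1 + r2 = if Q.1 = A.1 then
              (if Q.2 - c (-1) / 2 = A.2 - c (-1) / 2 then 1 else 0) +
              (if Q.2 - c (-1) / 2 = -(A.2 - c (-1) / 2) then 1 else 0) else 0 := by
          by_cases hx : Q.1 = A.1
          · obtain ⟨r1, r2, h1, h2, h3⟩ := one_dim (Q.2 - c (-1) / 2) (A.2 - c (-1) / 2)
            refine ⟨r1, r2, slope_vert_eq A Q hx _ _ h1, slope_vert_eq A Q hx _ _ h2, ?_⟩
            rw [if_pos hx, h3]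
          · exact ⟨0, 0, slope_vert_ne A Q hx _, slope_vert_ne A Q hx _, by rw [if_neg hx]; rfl⟩
        refine ⟨fun _ v hv => ?_, ?_⟩
        · rw [hdirs] at hv
          rcases hv with rfl | rfl
          · exact ⟨_, R1⟩
          · exact ⟨_, R2⟩
        · have hord : ord (Gam g c) (hfun g c A) Q = r1 + r2 := by
            have e1 := slope_eq (by rw [hdirs]; exact Or.inl rfl) R1
            have e2 := slope_eq (by rw [hdirs]; exact Or.inr rfl) R2
            unfold ord
            rw [hdirs, finsum_mem_pair (by simp), e1, e2]
          rw [hord, hr, hD]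
          have hz : (if Q.1 = 0 then
              (if Q.2 - c (-1) / 2 = 0 - c (-1) / 2 then (1 : ℤ) else 0) +
              (if Q.2 - c (-1) / 2 = -(0 - c (-1) / 2) then 1 else 0) else 0) = 0 := by
            by_cases h0 : Q.1 = 0
            · rw [h0, hP0] at hp h
              have h' := abs_lt.1 h
              rw [if_pos h0, if_neg (by intro h''; linarith), if_neg (by intro h''; linarith)]
              rfl
            · rw [if_neg h0]
          rw [hz, sub_zero]
    · refine ⟨fun h => absurd h hQ, ?_⟩
      have hord : ord (Gam g c) (hfun g c A) Q = 0 := by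
        unfold ord
        rw [localDirs_empty hc Q hQ, finsum_mem_empty]
      rw [hord, hD]
      have gen : ∀ B : ℝ × ℝ, B ∈ Gam g c → (if Q.1 = B.1 then
          (if Q.2 - c (-1) / 2 = B.2 - c (-1) / 2 then (1 : ℤ) else 0) +
          (if Q.2 - c (-1) / 2 = -(B.2 - c (-1) / 2) then 1 else 0) else 0) = 0 := by
        intro B hB
        rw [mem_Gam_iff hc] at hB hQ
        split_ifs with h1 h2 h3 h3
        all_goals first | rfl | skip
        all_goals
          exfalso
          apply hQ
          rw [h1]
          first
            | (rw [h2]; exact hB)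
            | (rw [h3, abs_neg]; exact hB)
      have hV : ((0, 0) : ℝ × ℝ) ∈ Gam g c := by
        rw [mem_Gam_iff hc]
        simp only [hP0]
        refine ⟨hA1.trans hA2, le_rfl, Or.inl ?_⟩
        have := Ptilde_pos hc 0
        rw [hP0] at this
        exact abs_of_pos this
      have g1 := gen A hA
      have g2 := gen _ hV
      simp only at g2
      rw [g1, g2]; rfl
  exact ⟨⟨hfun_cont hc A hA, fun Q hQ => (key Q).1 hQ⟩, fun Q => (key Q).2⟩

lemma hasSlope_add {S : Set (ℝ × ℝ)} {f f' : ℝ × ℝ → ℝ} {P : ℝ × ℝ} {v : ℤ × ℤ} {s s' : ℤ}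
    (h : HasSlope S f P v s) (h' : HasSlope S f' P v s') :
    HasSlope S (fun Q => f Q + f' Q) P v (s + s') := by
  obtain ⟨ε, hε, h⟩ := h
  obtain ⟨ε', hε', h'⟩ := h'
  refine ⟨min ε ε', lt_min hε hε', fun t h0 h1 hS => ?_⟩
  simp only
  rw [h t h0 (h1.trans_le (min_le_left _ _)) hS, h' t h0 (h1.trans_le (min_le_right _ _)) hS]
  push_cast; ring

lemma sum_main {g : ℕ} {c : ℤ → ℝ} (hc : Hyp g c) {ι : Type*} (s : Finset ι) (Pt : ι → ℝ × ℝ)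
    (hPt : ∀ i, Pt i ∈ Gam g c) :
    ∃ h : (ℝ × ℝ) → ℝ, IsRationalFn (Gam g c) h ∧
      ∀ P : ℝ × ℝ, (∑ i ∈ s, pairDiv g c (Pt i)) P = ord (Gam g c) h P := by
  classical
  induction s using Finset.induction_on with
  | empty =>
    have hz : ∀ P v, HasSlope (Gam g c) (fun _ => 0) P v 0 :=
      fun P v => ⟨1, one_pos, fun t _ _ _ => by simp⟩
    refine ⟨fun _ => 0, ⟨continuousOn_const, fun P _ v _ => ⟨0, hz P v⟩⟩, fun P => ?_⟩
    unfold ord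
    rw [finsum_mem_congr rfl (fun v hv => slope_eq hv (hz P v))]
    simp
  | insert a s ha ih =>
    obtain ⟨h, hr, ho⟩ := ih
    obtain ⟨hr', ho'⟩ := hfun_main hc (Pt a) (hPt a)
    refine ⟨fun Q => hfun g c (Pt a) Q + h Q, ⟨hr'.cont.add hr.cont, fun P hP v hv => ?_⟩,
      fun P => ?_⟩
    · obtain ⟨s1, h1⟩ := hr'.slope_int P hP v hv
      obtain ⟨s2, h2⟩ := hr.slope_int P hP v hv
      exact ⟨_, hasSlope_add h1 h2⟩
    · rw [Finset.sum_insert ha, Finsupp.add_apply, ho, ho']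
      by_cases hP : P ∈ Gam g c
      · unfold ord
        rw [← finsum_mem_add_distrib (localDirs_finite hc P)]
        refine finsum_mem_congr rfl (fun v hv => ?_)
        obtain ⟨s1, h1⟩ := hr'.slope_int P hP v hv
        obtain ⟨s2, h2⟩ := hr.slope_int P hP v hv
        rw [slope_eq hv h1, slope_eq hv h2, slope_eq hv (hasSlope_add h1 h2)]
      · unfold ord
        rw [localDirs_empty hc P hP]
        simp

end TropicalHyperelliptic

/-- Let `g` be odd, `Γ̄` the tropical hyperelliptic curve of genus `g`, `Γ` its
bounded part, and `D* = ((g−1)/2)(V_0 + V_0′) + V_0`.  For any points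
`P_1, …, P_{(g−1)/2}` on `Γ` with conjugates `P_1′, …, P_{(g−1)/2}′` there is a
rational function `h` on `Γ` with
`(h) = V_0 + P_1 + ⋯ + P_{(g−1)/2} + P_1′ + ⋯ + P_{(g−1)/2}′ − D*`;
equivalently, `(V_0 P_1 ⋯ P_{(g−1)/2} P_1′ ⋯ P_{(g−1)/2}′)
= φ̄(V_0 + Σ P_i + Σ P_i′) = 0` in `J(Γ)`. -/
theorem conj_pairs_sum_eq_zero_odd (g : ℕ) (c : ℤ → ℝ) (hg : Odd g) (hg1 : 1 ≤ g)
    (hc : Hyp g c) (Pt : Fin ((g - 1) / 2) → ℝ × ℝ) (hPt : ∀ i, Pt i ∈ Gam g c) :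
    ∃ h : (ℝ × ℝ) → ℝ, IsRationalFn (Gam g c) h ∧
      ∀ P : ℝ × ℝ,
        ((Finsupp.single (V g c 0) (1 : ℤ)
          + ∑ i : Fin ((g - 1) / 2),
              (Finsupp.single (Pt i) (1 : ℤ) + Finsupp.single (conj c (Pt i)) (1 : ℤ)))
          - DstarOdd g c) P = ord (Gam g c) h P := by
  obtain ⟨h, hr, ho⟩ := sum_main hc Finset.univ Pt hPt
  refine ⟨h, hr, fun P => ?_⟩
  rw [← ho P]
  congr 1
  unfold pairDiv DstarOdd
  rw [Finset.sum_sub_distrib, Finset.sum_const, Finset.card_univ, Fintype.card_fin,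
    natCast_zsmul]
  abel
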